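/- arXiv:1402.3506 — 2 statements merged into one kernel-verified Lean document; each statement's English description precedes it below -/
import Mathlib

section
/- Let Γ be a nonempty set, l ≥ 1 an integer, and let B' ⊆ (ℕ → Γ) be such that (Γ, B') is asynchronously l-complete. Let Z' and B'_S be the state set and behavior of the canonical state space system for B', and define the state machine P = (Z', Γ, δ, {λ}) with δ := { (ζ, σ, ζσ) : |ζ| < l and ζσ ∈ B'|[0,|ζ|] } ∪ { (ζ, σ, ζ[1,l−1]σ) : |ζ| = l and ζσ ∈ ⋃_{k'∈ℕ} B'|[k',k'+l] }, where ζσ denotes the string ζ with the symbol σ appended, and ζ[1,l−1] denotes ζ with its first symbol removed. Then the full behavior of P equals B'_S, i.e. B_f(P) = B'_S; moreover, if Γ is finite then Z' is finite, so P is a finite state machine. -/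
namespace LComplete

/-- The string `(γ s, γ (s+1), …, γ (s+len-1))`, i.e. the restriction `γ|[s, s+len-1]`. -/
def window {Γ : Type*} (γ : ℕ → Γ) (s len : ℕ) : List Γ :=
  (List.range len).map fun i => γ (s + i)

/-- The set of restrictions `B|[s, s+len-1]` of all signals in the behavior `B`. -/
def windowSet {Γ : Type*} (B : Set (ℕ → Γ)) (s len : ℕ) : Set (List Γ) :=
  (fun γ => window γ s len) '' B

/-- `(Γ, B)` is asynchronously `m`-complete: a signal belongs to `B` iff its initial
string of length `m` is an initial string of `B` and every sliding window of length
`m+1` occurs somewhere in `B`. -/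
def AsyncComplete {Γ : Type*} (m : ℕ) (B : Set (ℕ → Γ)) : Prop :=
  ∀ γ : ℕ → Γ,
    γ ∈ B ↔ (window γ 0 m ∈ windowSet B 0 m ∧
      ∀ k : ℕ, ∃ k' : ℕ, window γ k (m + 1) ∈ windowSet B k' (m + 1))

/-- The behavior `B^{m↑}` of the strongest asynchronous `m`-complete approximation. -/
def lift {Γ : Type*} (m : ℕ) (B : Set (ℕ → Γ)) : Set (ℕ → Γ) :=
  { γ | window γ 0 m ∈ windowSet B 0 m ∧
      ∀ k : ℕ, ∃ k' : ℕ, window γ k (m + 1) ∈ windowSet B k' (m + 1) }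

/-- The concatenation `w₁ ∧_{t₁}^{t₂} w₂`. -/
def concat {V : Type*} (w₁ w₂ : ℕ → V) (t₁ t₂ : ℕ) : ℕ → V :=
  fun t => if t < t₁ then w₁ t else w₂ (t - t₁ + t₂)

/-- `BS` is an asynchronous state space system. -/
def IsAsyncSS {W X : Type*} (BS : Set ((ℕ → W) × (ℕ → X))) : Prop :=
  ∀ p ∈ BS, ∀ q ∈ BS, ∀ t₁ t₂ : ℕ, p.2 t₁ = q.2 t₂ →
    (concat p.1 q.1 t₁ t₂, concat p.2 q.2 t₁ t₂) ∈ BS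

/-- State set `Z'` of the canonical state space system for `B'`. -/
def canonState {Γ : Type*} (l : ℕ) (B' : Set (ℕ → Γ)) : Set (List Γ) :=
  { ζ | (ζ.length < l ∧ ζ ∈ windowSet B' 0 ζ.length) ∨
        (ζ.length = l ∧ ∃ k : ℕ, ζ ∈ windowSet B' k l) }

/-- Behavior `B'_S` of the canonical state space system for `B'`. -/
def canonBeh {Γ : Type*} (l : ℕ) (B' : Set (ℕ → Γ)) :
    Set ((ℕ → Γ) × (ℕ → List Γ)) :=
  { p | p.1 ∈ B' ∧
      ∀ k : ℕ, p.2 k = if k < l then window p.1 0 k else window p.1 (k - l) l }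

/-- The external behavior of a state space behavior. -/
def extBeh {Γ X : Type*} (BS : Set ((ℕ → Γ) × (ℕ → X))) : Set (ℕ → Γ) :=
  { γ | ∃ x : ℕ → X, (γ, x) ∈ BS }

/-- `R` is an `m`-initial simulation relation from the system with behavior `BS₁`
to the system with behavior `BS₂`. -/
def InitSim {Γ X₁ X₂ : Type*} (m : ℕ) (BS₁ : Set ((ℕ → Γ) × (ℕ → X₁)))
    (BS₂ : Set ((ℕ → Γ) × (ℕ → X₂))) (R : Set (X₁ × X₂)) : Prop :=
  (∀ p ∈ BS₁, ∃ q ∈ BS₂, (p.2 m, q.2 m) ∈ R) ∧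
  (∀ p ∈ BS₁, ∀ q' ∈ BS₂, ∀ t₁ t₂ : ℕ, (p.2 t₁, q'.2 t₂) ∈ R →
    ∃ q ∈ BS₂,
      q.1 = concat q'.1 p.1 t₂ t₁ ∧
      (∀ t ≤ t₂, q.2 t = q'.2 t) ∧
      ∀ j : ℕ, 1 ≤ j → (p.2 (t₁ + j), q.2 (t₂ + j)) ∈ R)

/-- `R` is a synchronous simulation relation from the system with behavior `BS₁`
to the system with behavior `BS₂`. -/
def SyncSim {Γ X₁ X₂ : Type*} (BS₁ : Set ((ℕ → Γ) × (ℕ → X₁)))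
    (BS₂ : Set ((ℕ → Γ) × (ℕ → X₂))) (R : Set (X₁ × X₂)) : Prop :=
  (∀ t : ℕ, ∀ p ∈ BS₁, ∃ q ∈ BS₂, (p.2 t, q.2 t) ∈ R) ∧
  (∀ p ∈ BS₁, ∀ q' ∈ BS₂, ∀ t : ℕ, (p.2 t, q'.2 t) ∈ R →
    ∃ q ∈ BS₂,
      q.1 = concat q'.1 p.1 t t ∧
      (∀ s ≤ t, q.2 s = q'.2 s) ∧
      ∀ j : ℕ, 1 ≤ j → (p.2 (t + j), q.2 (t + j)) ∈ R)

/-- `X^{k,ζ}`: states reached at time `k` with recent past `ζ`. -/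
def reachAt {Γ X : Type*} (BS : Set ((ℕ → Γ) × (ℕ → X))) (k : ℕ) (ζ : List Γ) :
    Set X :=
  { ξ | ∃ p ∈ BS, p.2 k = ξ ∧ window p.1 (k - ζ.length) ζ.length = ζ }

/-- `X_ζ`: states compatible with recent past `ζ`. -/
def reach {Γ X : Type*} (BS : Set ((ℕ → Γ) × (ℕ → X))) (ζ : List Γ) : Set X :=
  { ξ | ∃ k : ℕ, ζ.length ≤ k ∧ ξ ∈ reachAt BS k ζ }

/-- The relation `R₀ ⊆ X × Z'`. -/
def R0 {Γ X : Type*} (l : ℕ) (BS : Set ((ℕ → Γ) × (ℕ → X))) (B : Set (ℕ → Γ)) :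
    Set (X × List Γ) :=
  { p | p.2 ∈ canonState l (lift l B) ∧
      ((p.2.length < l ∧ p.1 ∈ reachAt BS p.2.length p.2) ∨
       (p.2.length = l ∧ p.1 ∈ reach BS p.2)) }

/-- The relation `R_l ⊆ X × Z'`. -/
def Rl {Γ X : Type*} (l : ℕ) (BS : Set ((ℕ → Γ) × (ℕ → X))) (B : Set (ℕ → Γ)) :
    Set (X × List Γ) :=
  { p | p.2 ∈ canonState l (lift l B) ∧ p.2.length = l ∧ p.1 ∈ reach BS p.2 }

/-- The relation `R_X ⊆ X × X`. -/
def RX {Γ X : Type*} (l : ℕ) (BS : Set ((ℕ → Γ) × (ℕ → X))) : Set (X × X) :=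
  { p | ∃ ζ : List Γ, ζ.length = l ∧ p.1 ∈ reach BS ζ ∧ p.2 ∈ reach BS ζ }

/-- The inverse of a relation. -/
def inv {X₁ X₂ : Type*} (R : Set (X₁ × X₂)) : Set (X₂ × X₁) :=
  { p | (p.2, p.1) ∈ R }

/-- The full behavior `B_f(P)` of a state machine `P = (X, W, δ, X₀)`. -/
def fullBeh {W X : Type*} (δ : Set (X × W × X)) (X₀ : Set X) :
    Set ((ℕ → W) × (ℕ → X)) :=
  { p | p.2 0 ∈ X₀ ∧ ∀ t : ℕ, (p.2 t, p.1 t, p.2 (t + 1)) ∈ δ }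

/-- The transition relation `δ` of the canonical realization of `B'`. -/
def canonDelta {Γ : Type*} (l : ℕ) (B' : Set (ℕ → Γ)) :
    Set (List Γ × Γ × List Γ) :=
  { t | (t.1.length < l ∧ t.2.2 = t.1 ++ [t.2.1] ∧
          t.1 ++ [t.2.1] ∈ windowSet B' 0 (t.1.length + 1)) ∨
        (t.1.length = l ∧ t.2.2 = t.1.tail ++ [t.2.1] ∧
          ∃ k' : ℕ, t.1 ++ [t.2.1] ∈ windowSet B' k' (l + 1)) }

end LComplete

namespace LComplete

variable {Γ : Type*}

@[simp]
theorem length_window (γ : ℕ → Γ) (s n : ℕ) : (window γ s n).length = n := by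
  simp [window]

theorem window_succ (γ : ℕ → Γ) (s n : ℕ) :
    window γ s (n + 1) = window γ s n ++ [γ (s + n)] := by
  simp [window, List.range_succ]

theorem tail_window_succ (γ : ℕ → Γ) (s n : ℕ) :
    (window γ s (n + 1)).tail = window γ (s + 1) n := by
  simp only [window, List.range_succ_eq_map, List.map_cons, List.tail_cons, List.map_map]
  refine List.map_congr_left fun i _ => ?_
  simp [Nat.add_assoc, Nat.add_comm 1]

theorem tail_window_append {l : ℕ} (hl : 1 ≤ l) (γ : ℕ → Γ) (s : ℕ) :
    (window γ s l).tail ++ [γ (s + l)] = window γ (s + 1) l := by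
  obtain ⟨n, rfl⟩ := Nat.exists_eq_add_of_le' hl
  rw [tail_window_succ, window_succ, Nat.add_right_comm s 1 n, Nat.add_assoc s n 1]

/-- The state at time `k` of the canonical state space system under the signal `γ`. -/
def recentPast (l : ℕ) (γ : ℕ → Γ) (k : ℕ) : List Γ :=
  if k < l then window γ 0 k else window γ (k - l) l

theorem recentPast_of_le {l k : ℕ} (h : k ≤ l) (γ : ℕ → Γ) :
    recentPast l γ k = window γ 0 k := by
  rcases h.lt_or_eq with h | rfl <;> simp [recentPast, *]

theorem recentPast_add (l : ℕ) (γ : ℕ → Γ) (k : ℕ) :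
    recentPast l γ (k + l) = window γ k l := by
  simp [recentPast]

theorem recentPast_succ_of_lt {l k : ℕ} (h : k < l) (γ : ℕ → Γ) :
    recentPast l γ (k + 1) = recentPast l γ k ++ [γ k] := by
  rw [recentPast_of_le h, recentPast_of_le h.le, window_succ, Nat.zero_add]

theorem recentPast_add_succ {l : ℕ} (hl : 1 ≤ l) (γ : ℕ → Γ) (k : ℕ) :
    recentPast l γ (k + l + 1) = (recentPast l γ (k + l)).tail ++ [γ (k + l)] := by
  rw [Nat.add_right_comm, recentPast_add, recentPast_add, tail_window_append hl]

/-- Once the state is known to be the recent past, a transition of the canonical realization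
before time `l` is an update of the state together with an initial string of `B`. -/
theorem mem_canonDelta_of_lt {l k : ℕ} (h : k < l) {B : Set (ℕ → Γ)} {γ : ℕ → Γ}
    {ζ : List Γ} :
    (recentPast l γ k, γ k, ζ) ∈ canonDelta l B ↔
      ζ = recentPast l γ (k + 1) ∧ window γ 0 (k + 1) ∈ windowSet B 0 (k + 1) := by
  rw [recentPast_succ_of_lt h, recentPast_of_le h.le, window_succ, Nat.zero_add]
  simp [canonDelta, h, h.ne]

/-- From time `l` on, a transition of the canonical realization is an update of the state
together with a string of length `l + 1` that occurs somewhere in `B`. -/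
theorem mem_canonDelta_add {l : ℕ} (hl : 1 ≤ l) {B : Set (ℕ → Γ)} {γ : ℕ → Γ} {k : ℕ}
    {ζ : List Γ} :
    (recentPast l γ (k + l), γ (k + l), ζ) ∈ canonDelta l B ↔
      ζ = recentPast l γ (k + l + 1) ∧
        ∃ k', window γ k (l + 1) ∈ windowSet B k' (l + 1) := by
  rw [recentPast_add_succ hl, recentPast_add, window_succ]
  simp [canonDelta]

theorem eq_recentPast_of_mem_fullBeh {l : ℕ} (hl : 1 ≤ l) {B : Set (ℕ → Γ)}
    {γ : ℕ → Γ} {x : ℕ → List Γ} (h : (γ, x) ∈ fullBeh (canonDelta l B) {[]}) (k : ℕ) :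
    x k = recentPast l γ k := by
  induction k with
  | zero => simpa [recentPast_of_le, window] using h.1
  | succ k ih =>
    have ht := h.2 k
    simp only [ih] at ht
    rcases lt_or_ge k l with hk | hk
    · exact ((mem_canonDelta_of_lt hk).1 ht).1
    · obtain ⟨j, rfl⟩ := Nat.exists_eq_add_of_le' hk
      exact ((mem_canonDelta_add hl).1 ht).1

theorem fullBeh_canonDelta {l : ℕ} (hl : 1 ≤ l) {B : Set (ℕ → Γ)}
    (hB : AsyncComplete l B) : fullBeh (canonDelta l B) {[]} = canonBeh l B := by
  ext ⟨γ, x⟩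
  constructor
  · intro h
    obtain rfl : x = recentPast l γ := funext (eq_recentPast_of_mem_fullBeh hl h)
    refine ⟨(hB γ).2 ⟨?_, fun k => ((mem_canonDelta_add hl).1 (h.2 (k + l))).2⟩, fun _ => rfl⟩
    obtain ⟨n, rfl⟩ := Nat.exists_eq_add_of_le' hl
    exact ((mem_canonDelta_of_lt n.lt_succ_self).1 (h.2 n)).2
  · rintro ⟨hγ, hx⟩
    obtain rfl : x = recentPast l γ := funext hx
    refine ⟨by simp [recentPast_of_le, window], fun k => ?_⟩
    rcases lt_or_ge k l with hk | hk
    · exact (mem_canonDelta_of_lt hk).2 ⟨rfl, γ, hγ, rfl⟩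
    · obtain ⟨j, rfl⟩ := Nat.exists_eq_add_of_le' hk
      exact (mem_canonDelta_add hl).2 ⟨rfl, ((hB γ).1 hγ).2 j⟩

theorem finite_canonState [Finite Γ] (l : ℕ) (B : Set (ℕ → Γ)) : (canonState l B).Finite :=
  (List.finite_length_le Γ l).subset fun _ h => h.elim (fun h => h.1.le) fun h => h.1.le

end LComplete

/-- the state machine `P = (Z', Γ, δ, {λ})` realizes the canonical state
space system, i.e. `B_f(P) = B'_S`; moreover `Z'` is finite whenever `Γ` is finite. -/
theorem canon_realization {Γ : Type*} [Nonempty Γ] (l : ℕ) (hl : 1 ≤ l)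
    (B' : Set (ℕ → Γ)) (hB' : LComplete.AsyncComplete l B') :
    LComplete.fullBeh (LComplete.canonDelta l B') {([] : List Γ)} =
        LComplete.canonBeh l B' ∧
      (Finite Γ → (LComplete.canonState l B').Finite) := by
  exact ⟨LComplete.fullBeh_canonDelta hl hB', fun _ => LComplete.finite_canonState l B'⟩
end

section
/- Fix l ≥ 1, let Σ_S be given by an asynchronous state space system B_S of trajectories ℕ → Γ × X with external behavior B, and let Σ_S^{l↑} be the canonical state space system for B^{l↑}. Then the relation R_l is an l-initial simulation relation from Σ_S to Σ_S^{l↑}; in particular, the original system is l-initially simulated by its strongest asynchronous l-complete approximation. -/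
namespace LComplete

@[simp]
theorem window_length {Γ : Type*} (γ : ℕ → Γ) (s len : ℕ) : (window γ s len).length = len := by
  simp [window]

theorem window_eq_window_iff {Γ : Type*} {γ γ' : ℕ → Γ} {s s' len : ℕ} :
    window γ s len = window γ' s' len ↔ ∀ i < len, γ (s + i) = γ' (s' + i) := by
  simp [window, List.map_inj_left]

theorem subset_lift {Γ : Type*} (m : ℕ) (B : Set (ℕ → Γ)) : B ⊆ lift m B :=
  fun γ hγ => ⟨⟨γ, hγ, rfl⟩, fun k => ⟨k, γ, hγ, rfl⟩⟩

theorem mem_reach_window {Γ X : Type*} {BS : Set ((ℕ → Γ) × (ℕ → X))}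
    {p : (ℕ → Γ) × (ℕ → X)} (hp : p ∈ BS) (s len : ℕ) :
    p.2 (s + len) ∈ reach BS (window p.1 s len) :=
  ⟨s + len, by simp, p, hp, rfl, by simp⟩

theorem window_mem_canonState {Γ : Type*} {l : ℕ} {B' : Set (ℕ → Γ)} {γ : ℕ → Γ}
    (hγ : γ ∈ B') (s : ℕ) : window γ s l ∈ canonState l B' :=
  Or.inr ⟨window_length _ _ _, s, γ, hγ, rfl⟩

/-- A signal that follows `γ₁ ∈ B^{m↑}` before time `s + m` and a shifted signal
`γ₂ ∈ B` from time `s` on belongs to `B^{m↑}`. -/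
theorem mem_lift_of_eq {Γ : Type*} {m : ℕ} {B : Set (ℕ → Γ)} {γ γ₁ γ₂ : ℕ → Γ} {s s' : ℕ}
    (h₁ : γ₁ ∈ lift m B) (h₂ : γ₂ ∈ B) (hl : ∀ t < s + m, γ t = γ₁ t)
    (hr : ∀ n, γ (s + n) = γ₂ (s' + n)) : γ ∈ lift m B := by
  refine ⟨?_, fun k => ?_⟩
  · rw [window_eq_window_iff.2 fun i hi => hl (0 + i) (by omega)]
    exact h₁.1
  · rcases lt_or_ge k s with hk | hk
    · rw [window_eq_window_iff.2 fun i hi => hl (k + i) (by omega)]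
      exact h₁.2 k
    · obtain ⟨n, rfl⟩ := Nat.exists_eq_add_of_le hk
      refine ⟨s' + n, γ₂, h₂, window_eq_window_iff.2 fun i _ => ?_⟩
      rw [add_assoc, add_assoc, hr]

end LComplete

open LComplete

/-- `R_l` is an `l`-initial simulation relation from the original system
`Σ_S` to `Σ_S^{l↑}`: the original system is `l`-initially simulated by its strongest
asynchronous `l`-complete approximation. -/
theorem Rl_initSim {Γ X : Type*} [Nonempty Γ] (l : ℕ) (hl : 1 ≤ l)
    (BS : Set ((ℕ → Γ) × (ℕ → X))) (hBS : LComplete.IsAsyncSS BS)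
    (B : Set (ℕ → Γ)) (hB : B = LComplete.extBeh BS) :
    LComplete.InitSim l BS (LComplete.canonBeh l (LComplete.lift l B))
      (LComplete.Rl l BS B) := by
  subst hB
  refine ⟨fun p hp => ?_, fun p hp q' hq' t₁ t₂ ⟨_, hlen, k, hk, r, hr, hrk, hrw⟩ => ?_⟩
  · have hγ : p.1 ∈ lift l (extBeh BS) := subset_lift _ _ ⟨p.2, hp⟩
    refine ⟨(p.1, fun k => if k < l then window p.1 0 k else window p.1 (k - l) l),
      ⟨hγ, fun _ => rfl⟩, ?_⟩
    simpa [Rl, window_mem_canonState hγ] using mem_reach_window hp 0 l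
  · dsimp only at hlen hk hrk hrw
    rw [hlen] at hk hrw
    have ht₂ : l ≤ t₂ := by
      by_contra h
      rw [hq'.2, if_pos (by omega), window_length] at hlen
      omega
    rw [hq'.2, if_neg (by omega), window_eq_window_iff] at hrw
    obtain ⟨s, rfl⟩ := Nat.exists_eq_add_of_le' ht₂
    obtain ⟨s', rfl⟩ := Nat.exists_eq_add_of_le' hk
    simp only [Nat.add_sub_cancel] at hrw
    have hc := hBS r hr p hp (s' + l) t₁ hrk
    set c := (concat r.1 p.1 (s' + l) t₁, concat r.2 p.2 (s' + l) t₁) with hcdef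
    set γ := concat q'.1 p.1 (s + l) t₁ with hγdef
    have hleft : ∀ t < s + l, γ t = q'.1 t := fun t ht => if_pos ht
    have hright : ∀ n, γ (s + n) = c.1 (s' + n) := by
      intro n
      by_cases hn : n < l
      · simp [hγdef, hcdef, concat, hn, hrw n hn]
      · simp [hγdef, hcdef, concat, hn, Nat.add_sub_add_left]
    have hγ : γ ∈ lift l (extBeh BS) := mem_lift_of_eq hq'.1 ⟨c.2, hc⟩ hleft hright
    refine ⟨(γ, fun k => if k < l then window γ 0 k else window γ (k - l) l),
      ⟨hγ, fun _ => rfl⟩, rfl, fun t ht => ?_, fun j _ => ?_⟩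
    · rw [hq'.2]
      dsimp only
      split_ifs with h
      · exact window_eq_window_iff.2 fun i hi => hleft _ (by omega)
      · exact window_eq_window_iff.2 fun i hi => hleft _ (by omega)
    · have hstate : c.2 (s' + j + l) = p.2 (t₁ + j) := by
        simp only [hcdef, concat]
        rw [if_neg (by omega), show s' + j + l - (s' + l) + t₁ = t₁ + j by omega]
      have hwin : window γ (s + j) l = window c.1 (s' + j) l :=
        window_eq_window_iff.2 fun i _ => by rw [add_assoc, add_assoc, hright]
      have hsub : s + l + j - l = s + j := by omega
      have hnot : ¬ s + l + j < l := by omega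
      simp only [if_neg hnot, hsub]
      refine ⟨window_mem_canonState hγ _, window_length _ _ _, ?_⟩
      dsimp only
      rw [← hstate, hwin]
      exact mem_reach_window hc _ _
end
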